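/- For every probability distribution Γ over [0,1]×{0,1} and every ε > 0, the random interval calibration error satisfies RintCE(Γ,ε) ≤ (1 + 2/ε)·ldCE(Γ). -/

import Mathlib

open MeasureTheory Set

noncomputable section

/-- The unit interval `[0,1]` as a type. -/
abbrev I01 : Type := unitInterval

/-- The real value of a Boolean label. -/
def lbl (y : Bool) : ℝ := if y then 1 else 0

/-- The calibration correlation `E_{(v,y)∼Γ}[(y − v)·w(v)]` against a weight function `w`. -/
def calErr (Γ : Measure (I01 × Bool)) (w : I01 → ℝ) : ℝ :=
  ∫ p, (lbl p.2 - (p.1 : ℝ)) * w p.1 ∂Γ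

/-- A prediction-label distribution `Γ` on `[0,1] × {0,1}` is perfectly calibrated iff
`E[(y − v)·w(v)] = 0` for every bounded measurable weight function `w`. -/
def PerfCal (Γ : Measure (I01 × Bool)) : Prop :=
  ∀ w : I01 → ℝ, Measurable w → (∃ C : ℝ, ∀ t, |w t| ≤ C) → calErr Γ w = 0

/-- `ext(Γ)`: couplings `Π` of triples `(u,v,y)` whose `(v,y)`-marginal is `Γ` and whose
`(u,y)`-marginal is perfectly calibrated. -/
def extSet (Γ : Measure (I01 × Bool)) : Set (Measure (I01 × I01 × Bool)) :=
  {π | IsProbabilityMeasure π ∧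
    π.map (fun p => (p.2.1, p.2.2)) = Γ ∧
    PerfCal (π.map (fun p => (p.1, p.2.2)))}

/-- The lower distance to calibration `ldCE(Γ)`. -/
def ldCE (Γ : Measure (I01 × Bool)) : ℝ :=
  sInf {x | ∃ π ∈ extSet Γ, x = ∫ p, |(p.1 : ℝ) - (p.2.1 : ℝ)| ∂π}

/-- The upper distance to calibration `udCE(Γ)`: distance to calibration via post-processing. -/
def udCE (Γ : Measure (I01 × Bool)) : ℝ :=
  sInf {x | ∃ κ : I01 → I01, Measurable κ ∧
    PerfCal (Γ.map (fun p => (κ p.1, p.2))) ∧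
    x = ∫ p, |(p.1 : ℝ) - (κ p.1 : ℝ)| ∂Γ}

/-- The smooth calibration error `smCE(Γ)`: supremum of `E[(y−v)w(v)]` over `1`-Lipschitz
weight functions `w : [0,1] → [−1,1]`. -/
def smCE (Γ : Measure (I01 × Bool)) : ℝ :=
  sSup {x | ∃ w : I01 → ℝ, LipschitzWith 1 w ∧ (∀ t, |w t| ≤ 1) ∧ x = calErr Γ w}

/-- The prediction-label distribution `D_f` induced by a predictor `f`. -/
def predDist {𝒳 : Type*} [MeasurableSpace 𝒳] (D : Measure (𝒳 × Bool)) (f : 𝒳 → I01) :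
    Measure (I01 × Bool) :=
  D.map (fun p => (f p.1, p.2))

/-- `cal(D)`: the set of measurable predictors that are perfectly calibrated w.r.t. `D`. -/
def calSet {𝒳 : Type*} [MeasurableSpace 𝒳] (D : Measure (𝒳 × Bool)) : Set (𝒳 → I01) :=
  {g | Measurable g ∧ PerfCal (predDist D g)}

/-- The true (ℓ₁) distance to calibration `dCE_D(f)`. -/
def dCE {𝒳 : Type*} [MeasurableSpace 𝒳] (D : Measure (𝒳 × Bool)) (f : 𝒳 → I01) : ℝ :=
  sInf {x | ∃ g ∈ calSet D, x = ∫ p, |(f p.1 : ℝ) - (g p.1 : ℝ)| ∂D}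

/-- A finite partition of `[0,1]` into (order-convex) intervals. -/
structure IntervalPartition where
  m : ℕ
  piece : Fin m → Set ℝ
  ordConn : ∀ j, (piece j).OrdConnected
  disj : ∀ i j, i ≠ j → Disjoint (piece i) (piece j)
  cover : (⋃ j, piece j) = Set.Icc (0 : ℝ) 1

/-- `binnedECE(Γ, 𝓘) = Σ_j |E[(v − y)·1(v ∈ I_j)]|`. -/
def binnedECE (Γ : Measure (I01 × Bool)) (P : IntervalPartition) : ℝ :=
  ∑ j : Fin P.m,
    |∫ p, Set.indicator (P.piece j) (fun _ => ((p.1 : ℝ) - lbl p.2)) (p.1 : ℝ) ∂Γ|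

/-- The average interval width `w_Γ(𝓘) = Σ_j E[1(v ∈ I_j)]·w(I_j)`. -/
def avgWidth (Γ : Measure (I01 × Bool)) (P : IntervalPartition) : ℝ :=
  ∑ j : Fin P.m,
    (∫ p, Set.indicator (P.piece j) (fun _ => (1 : ℝ)) (p.1 : ℝ) ∂Γ) * Metric.diam (P.piece j)

/-- The interval calibration error `intCE(Γ)`. -/
def intCE (Γ : Measure (I01 × Bool)) : ℝ :=
  sInf {x | ∃ P : IntervalPartition, x = binnedECE Γ P + avgWidth Γ P}

/-- The random interval calibration error `RintCE(Γ, ε)`, with `r` uniform on `[0, ε)` and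
intervals `I^ε_{r,j} = [r + jε, r + (j+1)ε)`. -/
def RintCE (Γ : Measure (I01 × Bool)) (ε : ℝ) : ℝ :=
  (1 / ε) * ∫ r in Set.Ico (0 : ℝ) ε,
    ∑' j : ℤ, |∫ p, Set.indicator (Set.Ico (r + (j : ℝ) * ε) (r + ((j : ℝ) + 1) * ε))
      (fun _ => (lbl p.2 - (p.1 : ℝ))) (p.1 : ℝ) ∂Γ|

/-- The surrogate interval calibration error `SintCE(Γ)`. -/
def SintCE (Γ : Measure (I01 × Bool)) : ℝ :=
  ⨅ k : ℕ, (RintCE Γ ((1 / 2) ^ k) + (1 / 2) ^ k)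

/-- The squared Laplace-kernel calibration error:
`K_Lap(Γ) = E[(y−v)(y′−v′)·exp(−|v−v′|)]` over two independent samples from `Γ`. -/
def KLap (Γ : Measure (I01 × Bool)) : ℝ :=
  ∫ q, (lbl q.1.2 - (q.1.1 : ℝ)) * (lbl q.2.2 - (q.2.1 : ℝ)) *
    Real.exp (-|(q.1.1 : ℝ) - (q.2.1 : ℝ)|) ∂(Γ.prod Γ)

/-- The squared Gaussian-kernel calibration error:
`K_Gauss(Γ) = E[(y−v)(y′−v′)·exp(−(v−v′)²)]` over two independent samples from `Γ`. -/
def KGauss (Γ : Measure (I01 × Bool)) : ℝ :=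
  ∫ q, (lbl q.1.2 - (q.1.1 : ℝ)) * (lbl q.2.2 - (q.2.1 : ℝ)) *
    Real.exp (-(((q.1.1 : ℝ) - (q.2.1 : ℝ)) ^ 2)) ∂(Γ.prod Γ)

lemma lbl_sub_abs_le (y : Bool) (v : I01) : |lbl y - (v : ℝ)| ≤ 1 := by
  have h0 := v.2.1
  have h1 := v.2.2
  cases y <;> simp only [lbl, abs_le] <;> constructor <;> simp <;> linarith

lemma u_sub_abs_le (u v : I01) : |(u : ℝ) - (v : ℝ)| ≤ 1 := by
  have h0 := v.2.1
  have h1 := v.2.2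
  have h2 := u.2.1
  have h3 := u.2.2
  rw [abs_le]; constructor <;> linarith

lemma measurable_lbl : Measurable lbl := measurable_from_top

lemma mem_bin_iff {ε : ℝ} (hε : 0 < ε) (r x : ℝ) (j : ℤ) :
    x ∈ Set.Ico (r + (j : ℝ) * ε) (r + ((j : ℝ) + 1) * ε) ↔ ⌊(x - r) / ε⌋ = j := by
  rw [Int.floor_eq_iff, le_div_iff₀ hε, div_lt_iff₀ hε, Set.mem_Ico]
  constructor <;> rintro ⟨h1, h2⟩ <;> constructor <;> linarith

lemma fract_int_eq {ε : ℝ} (v : ℝ) :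
    ∫ r in (0 : ℝ)..ε, Int.fract ((v - r) / ε) = ∫ r in (0 : ℝ)..ε, Int.fract (-r / ε) := by
  by_cases hε : ε = 0
  · simp [hε]
  have hp : Function.Periodic (fun r : ℝ => Int.fract (-r / ε)) ε := by
    intro r
    have : -(r + ε) / ε = -r / ε - 1 := by field_simp; ring
    simp only [this]
    exact Int.fract_sub_one _
  have h1 := intervalIntegral.integral_comp_sub_right (a := 0) (b := ε)
    (fun r : ℝ => Int.fract (-r / ε)) v
  have h2 := hp.intervalIntegral_add_eq (0 - v) 0
  rw [show 0 - v + ε = ε - v by ring, zero_add] at h2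
  rw [← h2, ← h1]
  congr 1
  ext r
  congr 1
  ring

lemma fract_intble (ε v : ℝ) (a b : ℝ) :
    IntervalIntegrable (fun r => Int.fract ((v - r) / ε)) volume a b := by
  apply IntervalIntegrable.mono_fun (intervalIntegrable_const (c := (1 : ℝ)))
  · exact (measurable_fract.comp (by fun_prop)).aestronglyMeasurable
  · refine Filter.Eventually.of_forall fun r => ?_
    simp only [Real.norm_eq_abs, abs_one]
    rw [
      abs_of_nonneg (Int.fract_nonneg ((v - r) / ε))]
    exact (Int.fract_lt_one _).le

/-- discretised distance -/
def DD (ε r u v : ℝ) : ℝ := |(⌊(v - r) / ε⌋ : ℝ) - (⌊(u - r) / ε⌋ : ℝ)|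

lemma DD_nonneg (ε r u v : ℝ) : 0 ≤ DD ε r u v := abs_nonneg _

lemma DD_int_aux {ε : ℝ} (hε : 0 < ε) (u v : ℝ) (huv : u ≤ v) :
    ∫ r in (0 : ℝ)..ε, DD ε r u v = v - u := by
  have h : ∀ r, DD ε r u v =
      (v - u) / ε - (Int.fract ((v - r) / ε) - Int.fract ((u - r) / ε)) := by
    intro r
    have hm : ⌊(u - r) / ε⌋ ≤ ⌊(v - r) / ε⌋ := Int.floor_mono (by gcongr)
    have hm' : (⌊(u - r) / ε⌋ : ℝ) ≤ ⌊(v - r) / ε⌋ := by exact_mod_cast hm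
    rw [DD, abs_of_nonneg (by linarith), Int.fract, Int.fract]
    ring
  simp only [h]
  rw [intervalIntegral.integral_sub (by simp)
    ((fract_intble _ _ _ _).sub (fract_intble _ _ _ _)),
    intervalIntegral.integral_sub (fract_intble _ _ _ _) (fract_intble _ _ _ _),
    fract_int_eq, fract_int_eq]
  simp
  field_simp

lemma DD_int {ε : ℝ} (hε : 0 < ε) (u v : ℝ) :
    ∫ r in Set.Ico (0 : ℝ) ε, DD ε r u v = |u - v| := by
  rw [integral_Ico_eq_integral_Ioc, ← intervalIntegral.integral_of_le hε.le]
  rcases le_total u v with h | h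
  · rw [DD_int_aux hε u v h, abs_sub_comm, abs_of_nonneg (by linarith)]
  · rw [abs_of_nonneg (sub_nonneg.2 h), ← DD_int_aux hε v u h]
    congr 1
    ext r
    exact abs_sub_comm _ _

lemma DD_bound {ε : ℝ} (hε : 0 < ε) (r : ℝ) (u v : I01) : DD ε r u v ≤ 1 / ε + 1 := by
  have h := u_sub_abs_le v u
  have h2 : |((v : ℝ) - r) / ε - ((u : ℝ) - r) / ε| ≤ 1 / ε := by
    rw [← sub_div, abs_div, abs_of_pos hε]
    gcongr
    simpa using h
  rw [DD]
  have a1 := Int.floor_le (((v : ℝ) - r) / ε)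
  have a2 := Int.lt_floor_add_one (((v : ℝ) - r) / ε)
  have a3 := Int.floor_le (((u : ℝ) - r) / ε)
  have a4 := Int.lt_floor_add_one (((u : ℝ) - r) / ε)
  rw [abs_le] at *
  constructor <;> linarith [h2.1, h2.2]

lemma DD_meas (ε : ℝ) :
    Measurable (fun q : ℝ × (I01 × I01 × Bool) => DD ε q.1 q.2.1 q.2.2.1) := by
  unfold DD
  fun_prop

lemma DD_meas' (ε r : ℝ) :
    Measurable (fun p : I01 × I01 × Bool => DD ε r p.1 p.2.1) := by
  unfold DD
  fun_prop

/-- the test integrand -/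
def ff (ε r : ℝ) (j : ℤ) (y : Bool) (v : I01) : ℝ :=
  (lbl y - (v : ℝ)) * (if ⌊((v : ℝ) - r) / ε⌋ = j then 1 else 0)

lemma wmeas (ε r : ℝ) (j : ℤ) :
    Measurable (fun v : I01 => (if ⌊((v : ℝ) - r) / ε⌋ = j then (1 : ℝ) else 0)) := by
  have : Measurable (fun v : I01 => ⌊((v : ℝ) - r) / ε⌋) := by fun_prop
  exact Measurable.ite (this (measurableSet_singleton j)) measurable_const measurable_const

lemma ff_meas (ε r : ℝ) (j : ℤ) :
    Measurable (fun p : I01 × Bool => ff ε r j p.2 p.1) := by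
  unfold ff
  exact ((measurable_lbl.comp measurable_snd).sub (by fun_prop)).mul
    ((wmeas ε r j).comp measurable_fst)

lemma ff_abs (ε r : ℝ) (j : ℤ) (y : Bool) (v : I01) :
    |ff ε r j y v| ≤ if ⌊((v : ℝ) - r) / ε⌋ = j then 1 else 0 := by
  unfold ff
  have := lbl_sub_abs_le y v
  split_ifs <;> simpa

lemma ff_abs_le_one (ε r : ℝ) (j : ℤ) (y : Bool) (v : I01) : |ff ε r j y v| ≤ 1 := by
  refine (ff_abs ε r j y v).trans ?_
  split_ifs <;> norm_num

lemma ff_sum (ε r : ℝ) (S : Finset ℤ) (y : Bool) (u v : I01) :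
    ∑ j ∈ S, |ff ε r j y v - ff ε r j y u| ≤ |(u : ℝ) - v| + 2 * DD ε r u v := by
  by_cases h : ⌊((v : ℝ) - r) / ε⌋ = ⌊((u : ℝ) - r) / ε⌋
  · have : ∀ j, |ff ε r j y v - ff ε r j y u| =
        if ⌊((u : ℝ) - r) / ε⌋ = j then |(u : ℝ) - v| else 0 := by
      intro j
      unfold ff
      rw [h]
      split_ifs
      · congr 1; ring
      · simp
    simp only [this, Finset.sum_ite_eq, DD, h]
    split_ifs <;> simp
  · have hD : 1 ≤ DD ε r u v := by
      unfold DD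
      have : 1 ≤ |⌊((v : ℝ) - r) / ε⌋ - ⌊((u : ℝ) - r) / ε⌋| :=
        Int.one_le_abs (sub_ne_zero.2 h)
      exact_mod_cast this
    have : ∑ j ∈ S, |ff ε r j y v - ff ε r j y u| ≤ ∑ j ∈ S,
        ((if ⌊((v : ℝ) - r) / ε⌋ = j then (1 : ℝ) else 0) +
          (if ⌊((u : ℝ) - r) / ε⌋ = j then (1 : ℝ) else 0)) := by
      apply Finset.sum_le_sum
      intro j _
      exact (abs_sub _ _).trans (add_le_add (ff_abs _ _ _ _ _) (ff_abs _ _ _ _ _))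
    rw [Finset.sum_add_distrib, Finset.sum_ite_eq, Finset.sum_ite_eq] at this
    have h3 := abs_nonneg ((u : ℝ) - v)
    split_ifs at this <;> linarith

lemma integrable_of_bdd {α : Type*} [MeasurableSpace α] (μ : Measure α) [IsFiniteMeasure μ]
    {f : α → ℝ} (hf : Measurable f) (C : ℝ) (h : ∀ x, |f x| ≤ C) : Integrable f μ :=
  Integrable.of_bound hf.aestronglyMeasurable C (Filter.Eventually.of_forall h)

lemma extSet_nonempty (Γ : Measure (I01 × Bool)) [IsProbabilityMeasure Γ] :
    (extSet Γ).Nonempty := by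
  have hl : ∀ y, 0 ≤ lbl y ∧ lbl y ≤ 1 := by intro y; cases y <;> simp [lbl]
  have hm : Measurable (fun p : I01 × Bool => lbl p.2) := measurable_lbl.comp measurable_snd
  have hi : Integrable (fun p : I01 × Bool => lbl p.2) Γ :=
    integrable_of_bdd Γ hm 1 (fun p => by rw [abs_of_nonneg (hl _).1]; exact (hl _).2)
  have hc0 : 0 ≤ ∫ p, lbl p.2 ∂Γ := integral_nonneg fun p => (hl _).1
  have hc1 : ∫ p, lbl p.2 ∂Γ ≤ 1 := by
    have := integral_mono hi (integrable_const (1 : ℝ)) (fun p => (hl p.2).2)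
    simpa using this
  let c : I01 := ⟨∫ p, lbl p.2 ∂Γ, hc0, hc1⟩
  have hg : Measurable (fun p : I01 × Bool => (c, p.1, p.2)) := by fun_prop
  refine ⟨Γ.map (fun p => (c, p.1, p.2)), ?_, ?_, ?_⟩
  · exact Measure.isProbabilityMeasure_map hg.aemeasurable
  · rw [Measure.map_map (by fun_prop) hg]
    exact Measure.map_id
  · intro w hw _
    rw [Measure.map_map (by fun_prop) hg, calErr, integral_map]
    · simp only [Function.comp_def]
      rw [integral_mul_const, integral_sub hi (integrable_const _)]
      simp [c]
    · fun_prop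
    · exact ((hm.sub (by fun_prop)).mul (hw.comp measurable_fst)).aestronglyMeasurable

lemma e1_lem (Γ : Measure (I01 × Bool))
    (ε : ℝ) (hε : 0 < ε) (π : Measure (I01 × I01 × Bool)) [IsProbabilityMeasure π]
    (hΓ : π.map (fun p => (p.2.1, p.2.2)) = Γ)
    (hcal : PerfCal (π.map (fun p => (p.1, p.2.2)))) (r : ℝ) (j : ℤ) :
    (∫ p, Set.indicator
      (Set.Ico (r + (j : ℝ) * ε) (r + ((j : ℝ) + 1) * ε))
      (fun _ => (lbl p.2 - (p.1 : ℝ))) (p.1 : ℝ) ∂Γ) =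
        ∫ p, (ff ε r j p.2.2 p.2.1 - ff ε r j p.2.2 p.1) ∂π := by
  have hz := hcal (fun v => if ⌊((v : ℝ) - r) / ε⌋ = j then (1 : ℝ) else 0) (wmeas ε r j)
    ⟨1, fun t => by split_ifs <;> simp⟩
  rw [calErr] at hz
  change ∫ p : I01 × Bool, ff ε r j p.2 p.1 ∂_ = 0 at hz
  rw [integral_map (by fun_prop) (ff_meas ε r j).aestronglyMeasurable] at hz
  have m1 : Measurable (fun p : I01 × I01 × Bool => ff ε r j p.2.2 p.2.1) :=
    (ff_meas ε r j).comp measurable_snd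
  have m2 : Measurable (fun p : I01 × I01 × Bool => ff ε r j p.2.2 p.1) :=
    (ff_meas ε r j).comp (measurable_fst.prodMk (measurable_snd.comp measurable_snd))
  rw [integral_sub (integrable_of_bdd π m1 1 fun p => ff_abs_le_one _ _ _ _ _)
    (integrable_of_bdd π m2 1 fun p => ff_abs_le_one _ _ _ _ _), hz, sub_zero]
  have : (fun p : I01 × Bool => Set.indicator
      (Set.Ico (r + (j : ℝ) * ε) (r + ((j : ℝ) + 1) * ε))
      (fun _ => (lbl p.2 - (p.1 : ℝ))) (p.1 : ℝ)) = fun p => ff ε r j p.2 p.1 := by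
    ext p
    simp only [Set.indicator, mem_bin_iff hε, ff]
    split_ifs <;> simp
  rw [this, ← hΓ, integral_map (by fun_prop) (ff_meas ε r j).aestronglyMeasurable]

lemma key_lem (ε : ℝ) (π : Measure (I01 × I01 × Bool)) [IsProbabilityMeasure π] (r : ℝ)
    (i1 : Integrable (fun p : I01 × I01 × Bool => |(p.1 : ℝ) - (p.2.1 : ℝ)|) π)
    (i2 : Integrable (fun p : I01 × I01 × Bool => DD ε r p.1 p.2.1) π) :
    (∑' j : ℤ, |∫ p, (ff ε r j p.2.2 p.2.1 - ff ε r j p.2.2 p.1) ∂π|) ≤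
      (∫ p, |(p.1 : ℝ) - (p.2.1 : ℝ)| ∂π) + 2 * ∫ p, DD ε r p.1 p.2.1 ∂π := by
  refine Real.tsum_le_of_sum_le (fun j => abs_nonneg _) fun S => ?_
  have mj : ∀ j, Integrable (fun p : I01 × I01 × Bool =>
      |ff ε r j p.2.2 p.2.1 - ff ε r j p.2.2 p.1|) π := by
    intro j
    have m1 : Measurable (fun p : I01 × I01 × Bool => ff ε r j p.2.2 p.2.1) :=
      (ff_meas ε r j).comp measurable_snd
    have m2 : Measurable (fun p : I01 × I01 × Bool => ff ε r j p.2.2 p.1) :=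
      (ff_meas ε r j).comp (measurable_fst.prodMk (measurable_snd.comp measurable_snd))
    exact ((integrable_of_bdd π m1 1 fun p => ff_abs_le_one _ _ _ _ _).sub
      (integrable_of_bdd π m2 1 fun p => ff_abs_le_one _ _ _ _ _)).abs
  calc _ ≤ ∑ j ∈ S, ∫ p, |ff ε r j p.2.2 p.2.1 - ff ε r j p.2.2 p.1| ∂π :=
        Finset.sum_le_sum fun j _ => abs_integral_le_integral_abs
    _ = ∫ p, ∑ j ∈ S, |ff ε r j p.2.2 p.2.1 - ff ε r j p.2.2 p.1| ∂π :=
        (integral_finsetSum S fun j _ => mj j).symm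
    _ ≤ ∫ p, (|(p.1 : ℝ) - (p.2.1 : ℝ)| + 2 * DD ε r p.1 p.2.1) ∂π :=
        integral_mono (integrable_finsetSum S fun j _ => mj j) (i1.add (i2.const_mul 2))
          fun p => ff_sum ε r S p.2.2 p.1 p.2.1
    _ = _ := by rw [integral_add i1 (i2.const_mul 2), integral_const_mul]

lemma final_lem (ε : ℝ) (hε : 0 < ε) (F G : ℝ → ℝ) (A : ℝ) (h0 : ∀ r, 0 ≤ F r)
    (hF : ∀ r, F r ≤ A + 2 * G r) (hG : Integrable G (volume.restrict (Set.Ico (0 : ℝ) ε)))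
    (e2 : ∫ r in Set.Ico (0 : ℝ) ε, G r = A) :
    (1 / ε) * ∫ r in Set.Ico (0 : ℝ) ε, F r ≤ (1 + 2 / ε) * A := by
  have step : ∫ r in Set.Ico (0 : ℝ) ε, F r ≤ ∫ r in Set.Ico (0 : ℝ) ε, (A + 2 * G r) :=
    integral_mono_of_nonneg (Filter.Eventually.of_forall h0)
      ((integrable_const A).add (hG.const_mul 2)) (Filter.Eventually.of_forall hF)
  rw [integral_add (integrable_const _) (hG.const_mul 2), integral_const_mul, e2] at step
  simp only [integral_const, smul_eq_mul, measureReal_restrict_apply_univ,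
    Real.volume_real_Ico_of_le hε.le, sub_zero] at step
  have h2 := mul_le_mul_of_nonneg_left step (show 0 ≤ 1 / ε by positivity)
  have h3 : 1 / ε * (ε * A + 2 * A) = (1 + 2 / ε) * A := by field_simp
  linarith

lemma main_bound (Γ : Measure (I01 × Bool)) [IsProbabilityMeasure Γ]
    (ε : ℝ) (hε : 0 < ε) (π : Measure (I01 × I01 × Bool)) (hπ : π ∈ extSet Γ) :
    RintCE Γ ε ≤ (1 + 2 / ε) * ∫ p, |(p.1 : ℝ) - (p.2.1 : ℝ)| ∂π := by
  obtain ⟨hP, hΓ, hcal⟩ := hπ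
  have i1 : Integrable (fun p : I01 × I01 × Bool => |(p.1 : ℝ) - (p.2.1 : ℝ)|) π :=
    integrable_of_bdd π (by fun_prop) 1 (fun p => by rw [abs_abs]; exact u_sub_abs_le _ _)
  have i2 : ∀ r, Integrable (fun p : I01 × I01 × Bool => DD ε r p.1 p.2.1) π := fun r =>
    integrable_of_bdd π (DD_meas' ε r) (1 / ε + 1)
      (fun p => by
        rw [abs_of_nonneg (DD_nonneg _ _ _ _)]; exact DD_bound hε _ _ _)
  have i3 : Integrable (fun q : ℝ × (I01 × I01 × Bool) => DD ε q.1 q.2.1 q.2.2.1)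
      ((volume.restrict (Set.Ico (0 : ℝ) ε)).prod π) :=
    integrable_of_bdd _ (DD_meas ε) (1 / ε + 1)
      (fun p => by
        rw [abs_of_nonneg (DD_nonneg _ _ _ _)]; exact DD_bound hε _ _ _)
  have key : ∀ r, (∑' j : ℤ, |∫ p, Set.indicator
      (Set.Ico (r + (j : ℝ) * ε) (r + ((j : ℝ) + 1) * ε))
      (fun _ => (lbl p.2 - (p.1 : ℝ))) (p.1 : ℝ) ∂Γ|) ≤
      (∫ p, |(p.1 : ℝ) - (p.2.1 : ℝ)| ∂π) + 2 * ∫ p, DD ε r p.1 p.2.1 ∂π := by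
    intro r
    simp only [e1_lem Γ ε hε π hΓ hcal]
    exact key_lem ε π r i1 (i2 r)
  have i4 : Integrable (fun r => ∫ p, DD ε r p.1 p.2.1 ∂π)
      (volume.restrict (Set.Ico (0 : ℝ) ε)) := i3.integral_prod_left
  have e2 : ∫ r in Set.Ico (0 : ℝ) ε, ∫ p, DD ε r p.1 p.2.1 ∂π =
      ∫ p, |(p.1 : ℝ) - (p.2.1 : ℝ)| ∂π := by
    rw [integral_integral_swap (f := fun r (p : I01 × I01 × Bool) => DD ε r p.1 p.2.1) i3]
    simp only [DD_int hε]
  generalize (∫ p, |(p.1 : ℝ) - (p.2.1 : ℝ)| ∂π) = A at *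
  generalize hG : (fun r => ∫ p, DD ε r p.1 p.2.1 ∂π) = G at *
  have hG' : ∀ r, ∫ p, DD ε r p.1 p.2.1 ∂π = G r := fun r => congrFun hG r
  simp only [hG'] at key e2
  rw [RintCE]
  generalize hF : (fun r : ℝ => ∑' j : ℤ, |∫ p, Set.indicator
      (Set.Ico (r + (j : ℝ) * ε) (r + ((j : ℝ) + 1) * ε))
      (fun _ => (lbl p.2 - (p.1 : ℝ))) (p.1 : ℝ) ∂Γ|) = F
  have hF' : ∀ r, F r ≤ A + 2 * G r := fun r => by rw [← hF]; exact key r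
  have hF0 : ∀ r, 0 ≤ F r := fun r => by rw [← hF]; exact tsum_nonneg fun j => abs_nonneg _
  exact final_lem ε hε F G A hF0 hF' i4 e2

/-- `RintCE(Γ, ε) ≤ (1 + 2/ε)·ldCE(Γ)`. -/
theorem RintCE_le_ldCE (Γ : Measure (I01 × Bool)) [IsProbabilityMeasure Γ]
    (ε : ℝ) (hε : 0 < ε) :
    RintCE Γ ε ≤ (1 + 2 / ε) * ldCE Γ := by
  have hc : 0 < 1 + 2 / ε := by positivity
  rw [mul_comm, ← div_le_iff₀ hc]
  obtain ⟨π₀, h₀⟩ := extSet_nonempty Γ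
  refine le_csInf ⟨_, π₀, h₀, rfl⟩ ?_
  rintro x ⟨π, hπ, rfl⟩
  rw [div_le_iff₀ hc, mul_comm]
  exact main_bound Γ ε hε π hπ
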